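/- Let ρ : ℝ → [0,1] be a measurable function, κ ≥ 0, and let γ be the standard Gaussian measure on ℝ. Define c_κ(s,r) = ∫∫ [ρ(κz₁)·((1 − κ·s·z₁ − r·z₂)₊)² + (1 − ρ(κz₁))·((1 + κ·s·z₁ − r·z₂)₊)²] dγ(z₁) dγ(z₂). Then the function (s,r) ↦ √(c_κ(s,r)) is jointly convex on ℝ × ℝ. -/

import Mathlib

open MeasureTheory ProbabilityTheory

/-- The summary functional `c_κ(s,r)` for a general (measurable, `[0,1]`-valued)
link function `ρ`:
`c_κ(s,r) = ∫∫ [ρ(κz₁)((1 - κ s z₁ - r z₂)₊)² + (1 - ρ(κz₁))((1 + κ s z₁ - r z₂)₊)²] dγ(z₁)dγ(z₂)`. -/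
noncomputable def summaryFunctional (ρ : ℝ → ℝ) (κ s r : ℝ) : ℝ :=
  ∫ z₁, ∫ z₂,
    (ρ (κ * z₁) * (max (1 - κ * s * z₁ - r * z₂) 0) ^ 2
      + (1 - ρ (κ * z₁)) * (max (1 + κ * s * z₁ - r * z₂) 0) ^ 2)
    ∂(gaussianReal 0 1) ∂(gaussianReal 0 1)

/-- Minkowski's inequality for pairs of square-integrable functions. -/
lemma sqrt_integral_add_sq_add_sq_le {α : Type*} [MeasurableSpace α] {μ : Measure α}
    {u₁ v₁ u₂ v₂ : α → ℝ} (hu₁ : MemLp u₁ 2 μ) (hv₁ : MemLp v₁ 2 μ)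
    (hu₂ : MemLp u₂ 2 μ) (hv₂ : MemLp v₂ 2 μ) :
    √(∫ x, (u₁ x + u₂ x) ^ 2 + (v₁ x + v₂ x) ^ 2 ∂μ) ≤
      √(∫ x, u₁ x ^ 2 + v₁ x ^ 2 ∂μ) + √(∫ x, u₂ x ^ 2 + v₂ x ^ 2 ∂μ) := by
  have i₁ : Integrable (fun x => u₁ x ^ 2 + v₁ x ^ 2) μ := hu₁.integrable_sq.add hv₁.integrable_sq
  have i₂ : Integrable (fun x => u₂ x ^ 2 + v₂ x ^ 2) μ := hu₂.integrable_sq.add hv₂.integrable_sq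
  have i₁₂ : Integrable (fun x => u₁ x * u₂ x + v₁ x * v₂ x) μ :=
    (hu₁.integrable_mul hu₂).add (hv₁.integrable_mul hv₂)
  set A := ∫ x, u₁ x ^ 2 + v₁ x ^ 2 ∂μ
  set B := ∫ x, u₂ x ^ 2 + v₂ x ^ 2 ∂μ
  set C := ∫ x, u₁ x * u₂ x + v₁ x * v₂ x ∂μ
  have expand (t : ℝ) :
      ∫ x, (t * u₁ x + u₂ x) ^ 2 + (t * v₁ x + v₂ x) ^ 2 ∂μ = A * (t * t) + 2 * C * t + B := by
    calc
      _ = ∫ x, (t * t) * (u₁ x ^ 2 + v₁ x ^ 2) + (2 * t) * (u₁ x * u₂ x + v₁ x * v₂ x)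
            + (u₂ x ^ 2 + v₂ x ^ 2) ∂μ := by congr 1; ext x; ring
      _ = (t * t) * A + (2 * t) * C + B := by
        have i₃ : Integrable (fun x => (t * t) * (u₁ x ^ 2 + v₁ x ^ 2)
            + (2 * t) * (u₁ x * u₂ x + v₁ x * v₂ x)) μ := (i₁.const_mul _).add (i₁₂.const_mul _)
        rw [integral_add i₃ i₂, integral_add (i₁.const_mul _) (i₁₂.const_mul _),
          integral_const_mul, integral_const_mul]
      _ = _ := by ring
  have hA : 0 ≤ A := integral_nonneg fun x => by positivity
  have hB : 0 ≤ B := integral_nonneg fun x => by positivity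
  have hdisc : C ^ 2 ≤ A * B := by
    have h := discrim_le_zero (a := A) (b := 2 * C) (c := B) fun t => by
      rw [← expand t]; exact integral_nonneg fun x => by positivity
    unfold discrim at h
    linarith
  have hC : C ≤ √A * √B := by
    rw [← Real.sqrt_mul hA]; exact Real.le_sqrt_of_sq_le hdisc
  have h₁ := expand 1
  simp only [one_mul] at h₁
  rw [h₁]
  apply Real.sqrt_le_iff.2 ⟨by positivity, ?_⟩
  nlinarith [Real.sq_sqrt hA, Real.sq_sqrt hB]

/-- Affine functions of two independent square-integrable variables have square-integrable
positive parts, also after multiplication with the square root of a weight that is at most one. -/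
lemma memLp_sqrt_mul_posPart_affine {μ ν : Measure ℝ} [IsProbabilityMeasure μ]
    [IsProbabilityMeasure ν] (hμ : MemLp id 2 μ) (hν : MemLp id 2 ν) {w : ℝ → ℝ}
    (hw : Measurable w) (hw1 : ∀ t, w t ≤ 1) (b c : ℝ) :
    MemLp (fun z : ℝ × ℝ => √(w z.1) * max (1 + b * z.1 - c * z.2) 0) 2 (μ.prod ν) := by
  have h₁ : MemLp (fun z : ℝ × ℝ => b * z.1) 2 (μ.prod ν) := (hμ.comp_fst ν).const_mul b
  have h₂ : MemLp (fun z : ℝ × ℝ => c * z.2) 2 (μ.prod ν) := (hν.comp_snd μ).const_mul c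
  have h₀ : MemLp (fun _ : ℝ × ℝ => (1 : ℝ)) 2 (μ.prod ν) := memLp_const 1
  have haff : MemLp (fun z : ℝ × ℝ => 1 + b * z.1 - c * z.2) 2 (μ.prod ν) := (h₀.add h₁).sub h₂
  refine haff.of_le (Measurable.aestronglyMeasurable (by fun_prop)) (ae_of_all _ fun z => ?_)
  rw [norm_mul, Real.norm_of_nonneg (Real.sqrt_nonneg _),
    Real.norm_of_nonneg (le_max_right _ 0), Real.norm_eq_abs]
  calc
    _ ≤ 1 * max (1 + b * z.1 - c * z.2) 0 :=
      mul_le_mul_of_nonneg_right (Real.sqrt_le_one.2 (hw1 _)) (le_max_right _ _)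
    _ ≤ _ := by rw [one_mul]; exact max_le (le_abs_self _) (abs_nonneg _)

/-- The summary functional as an integral over the product measure of a sum of two squares. -/
lemma summaryFunctional_eq_integral_prod {ρ : ℝ → ℝ} (hρmeas : Measurable ρ)
    (hρ : ∀ t, ρ t ∈ Set.Icc (0 : ℝ) 1) (κ s r : ℝ) :
    summaryFunctional ρ κ s r =
      ∫ z : ℝ × ℝ, (√(ρ (κ * z.1)) * max (1 + -(κ * s) * z.1 - r * z.2) 0) ^ 2
        + (√(1 - ρ (κ * z.1)) * max (1 + κ * s * z.1 - r * z.2) 0) ^ 2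
        ∂((gaussianReal 0 1).prod (gaussianReal 0 1)) := by
  have hid : MemLp id 2 (gaussianReal 0 1) := memLp_id_gaussianReal 2
  rw [integral_prod]
  · unfold summaryFunctional
    congr! 5 with z₁ z₂
    · rw [mul_pow, Real.sq_sqrt (hρ _).1, neg_mul, ← sub_eq_add_neg]
    · rw [mul_pow, Real.sq_sqrt (sub_nonneg.2 (hρ _).2)]
  · exact (memLp_sqrt_mul_posPart_affine hid hid (w := fun t => ρ (κ * t)) (by fun_prop)
      (fun t => (hρ _).2) _ _).integrable_sq.add
      (memLp_sqrt_mul_posPart_affine hid hid (w := fun t => 1 - ρ (κ * t)) (by fun_prop)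
      (fun t => by linarith [(hρ (κ * t)).1]) _ _).integrable_sq

/-- Convexity of the positive part of an affine function, as a bound on squares. -/
lemma sq_mul_posPart_affine_combo_le {w a a' b b' c c' x y : ℝ} (hw : 0 ≤ w) (ha : 0 ≤ a)
    (ha' : 0 ≤ a') (hab : a + a' = 1) :
    (w * max (1 + (a * b + a' * b') * x - (a * c + a' * c') * y) 0) ^ 2 ≤
      (a * (w * max (1 + b * x - c * y) 0) + a' * (w * max (1 + b' * x - c' * y) 0)) ^ 2 := by
  refine pow_le_pow_left₀ (by positivity) ?_ 2
  calc
    _ ≤ w * (a * max (1 + b * x - c * y) 0 + a' * max (1 + b' * x - c' * y) 0) := by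
      refine mul_le_mul_of_nonneg_left (max_le ?_ (by positivity)) hw
      calc
        _ = a * (1 + b * x - c * y) + a' * (1 + b' * x - c' * y) := by linear_combination -hab
        _ ≤ _ := by gcongr <;> exact le_max_left _ _
    _ = _ := by ring

/-- The function `(s,r) ↦ √(c_κ(s,r))` is jointly convex on `ℝ × ℝ`. -/
theorem sqrt_summaryFunctional_convexOn (ρ : ℝ → ℝ) (hρmeas : Measurable ρ)
    (hρ : ∀ t, ρ t ∈ Set.Icc (0 : ℝ) 1) (κ : ℝ) (hκ : 0 ≤ κ) :
    ConvexOn ℝ Set.univ (fun q : ℝ × ℝ => Real.sqrt (summaryFunctional ρ κ q.1 q.2)) := by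
  refine ⟨convex_univ, ?_⟩
  rintro ⟨s, r⟩ - ⟨s', r'⟩ - a a' ha ha' hab
  simp only [Prod.smul_mk, Prod.mk_add_mk, smul_eq_mul]
  have hid : MemLp id 2 (gaussianReal 0 1) := memLp_id_gaussianReal 2
  have hU (b c : ℝ) := memLp_sqrt_mul_posPart_affine hid hid (w := fun t => ρ (κ * t))
    (by fun_prop) (fun t => (hρ _).2) b c
  have hV (b c : ℝ) := memLp_sqrt_mul_posPart_affine hid hid (w := fun t => 1 - ρ (κ * t))
    (by fun_prop) (fun t => by linarith [(hρ (κ * t)).1]) b c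
  simp only [summaryFunctional_eq_integral_prod hρmeas hρ]
  have sqrt_scale {t : ℝ} (ht : 0 ≤ t) (u v : ℝ × ℝ → ℝ) (μ : Measure (ℝ × ℝ)) :
      t * √(∫ z, u z ^ 2 + v z ^ 2 ∂μ) = √(∫ z, (t * u z) ^ 2 + (t * v z) ^ 2 ∂μ) := by
    simp only [mul_pow, ← mul_add]
    rw [integral_const_mul, Real.sqrt_mul (sq_nonneg t), Real.sqrt_sq ht]
  rw [sqrt_scale ha, sqrt_scale ha']
  have hU₁ := (hU (-(κ * s)) r).const_mul a
  have hV₁ := (hV (κ * s) r).const_mul a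
  have hU₂ := (hU (-(κ * s')) r').const_mul a'
  have hV₂ := (hV (κ * s') r').const_mul a'
  refine (Real.sqrt_le_sqrt ?_).trans (sqrt_integral_add_sq_add_sq_le hU₁ hV₁ hU₂ hV₂)
  refine integral_mono ((hU _ _).integrable_sq.add (hV _ _).integrable_sq)
    ((hU₁.add hU₂).integrable_sq.add (hV₁.add hV₂).integrable_sq) fun z => ?_
  have e₁ : -(κ * (a * s + a' * s')) = a * -(κ * s) + a' * -(κ * s') := by ring
  have e₂ : κ * (a * s + a' * s') = a * (κ * s) + a' * (κ * s') := by ring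
  simp only [e₁]
  rw [e₂]
  exact add_le_add (sq_mul_posPart_affine_combo_le (Real.sqrt_nonneg _) ha ha' hab)
    (sq_mul_posPart_affine_combo_le (Real.sqrt_nonneg _) ha ha' hab)
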